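/- Induced matching for injections: Let V and W be persistence modules with V ≅ ⊕_{I∈B} 𝔽(I) and W ≅ ⊕_{J∈C} 𝔽(J) for finite multisets of intervals B and C. If there exists a morphism ι : V → W with ι_t injective for every t ∈ ℝ, then there exists an injective map μ from the multiset B into the multiset C, defined on all of B, such that for every bar (b,d] ∈ B the bar μ(b,d] has the form (c,d] with the same right endpoint d and with c ≤ b. -/

import Mathlib

open Classical

noncomputable section

/-- A persistence module over a field `𝔽`: a family of finite-dimensional vector
spaces indexed by `ℝ` together with transition maps satisfying the persistence laws. -/
structure PersistenceModule (𝔽 : Type) [Field 𝔽] where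
  V : ℝ → Type
  [grp : ∀ t, AddCommGroup (V t)]
  [mod : ∀ t, Module 𝔽 (V t)]
  [fin : ∀ t, FiniteDimensional 𝔽 (V t)]
  π : ∀ s t : ℝ, s ≤ t → (V s →ₗ[𝔽] V t)
  π_refl : ∀ t : ℝ, π t t le_rfl = LinearMap.id
  π_comp : ∀ (s t r : ℝ) (hst : s ≤ t) (htr : t ≤ r),
    (π t r htr).comp (π s t hst) = π s r (hst.trans htr)

attribute [instance] PersistenceModule.grp PersistenceModule.mod PersistenceModule.fin

namespace PersistenceModule

variable {𝔽 : Type} [Field 𝔽]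

/-- The regularity ("finite type", semicontinuity and lower-boundedness) axioms of a
persistence module: away from a finite set, transition maps are locally isomorphisms;
the module is semicontinuous from the left; and it vanishes for `s` sufficiently small. -/
def IsRegular (M : PersistenceModule 𝔽) : Prop :=
  (∃ S : Finset ℝ, ∀ t : ℝ, t ∉ S → ∃ U ∈ nhds t,
    ∀ s ∈ U, ∀ r ∈ U, ∀ h : s ≤ r, Function.Bijective (M.π s r h)) ∧
  (∀ t : ℝ, ∃ ε : ℝ, 0 < ε ∧ ∀ s : ℝ, t - ε < s → ∀ h : s ≤ t, Function.Bijective (M.π s t h)) ∧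
  (∃ s₀ : ℝ, ∀ s : ℝ, s ≤ s₀ → ∀ x : M.V s, x = 0)

/-- A morphism of persistence modules. -/
structure Hom (M N : PersistenceModule 𝔽) where
  A : ∀ t : ℝ, M.V t →ₗ[𝔽] N.V t
  comm : ∀ (s t : ℝ) (h : s ≤ t), (A t).comp (M.π s t h) = (N.π s t h).comp (A s)

/-- Two persistence modules are isomorphic if there are mutually inverse morphisms. -/
def Iso (M N : PersistenceModule 𝔽) : Prop :=
  ∃ (f : Hom M N) (g : Hom N M),
    (∀ (t : ℝ) (x : M.V t), g.A t (f.A t x) = x) ∧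
    (∀ (t : ℝ) (y : N.V t), f.A t (g.A t y) = y)

/-- `δ`-interleaving of two persistence modules, stated pointwise (`F, G` are the
interleaving morphisms `V → W[δ]`, `W → V[δ]`, and the two triangles express that the
compositions are the `2δ`-shift morphisms). -/
def Interleaved (M N : PersistenceModule 𝔽) (δ : ℝ) : Prop :=
  ∃ (F : ∀ t : ℝ, M.V t →ₗ[𝔽] N.V (t + δ)) (G : ∀ t : ℝ, N.V t →ₗ[𝔽] M.V (t + δ)),
    (∀ (s t : ℝ) (h : s ≤ t),
      (F t).comp (M.π s t h) = (N.π (s + δ) (t + δ) (by linarith)).comp (F s)) ∧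
    (∀ (s t : ℝ) (h : s ≤ t),
      (G t).comp (N.π s t h) = (M.π (s + δ) (t + δ) (by linarith)).comp (G s)) ∧
    (∀ (t : ℝ) (h : t ≤ t + δ + δ),
      (G (t + δ)).comp (F t) = M.π t (t + δ + δ) h) ∧
    (∀ (t : ℝ) (h : t ≤ t + δ + δ),
      (F (t + δ)).comp (G t) = N.π t (t + δ + δ) h)

/-- Interleaving distance, with value in `EReal` (`+∞` if no interleaving exists). -/
def dInt (M N : PersistenceModule 𝔽) : EReal :=
  sInf {x : EReal | ∃ δ : ℝ, 0 < δ ∧ x = (δ : EReal) ∧ Interleaved M N δ}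

/-- The persistence submodule of `(-1)`-eigenspaces of an endomorphism `A` of `M`. -/
def negEigen (M : PersistenceModule 𝔽) (A : Hom M M) : PersistenceModule 𝔽 where
  V t := ↥(LinearMap.ker (A.A t + (LinearMap.id : M.V t →ₗ[𝔽] M.V t)))
  π s t h := LinearMap.restrict (M.π s t h) (by
    intro x hx
    have hc := congrArg (fun f : M.V s →ₗ[𝔽] M.V t => f x) (A.comm s t h)
    simp only [LinearMap.comp_apply] at hc
    simp only [LinearMap.mem_ker, LinearMap.add_apply, LinearMap.id_apply] at hx ⊢
    rw [hc, ← map_add (M.π s t h), hx, map_zero])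
  π_refl t := by
    apply LinearMap.ext
    intro x
    apply Subtype.ext
    have := congrArg (fun f : M.V t →ₗ[𝔽] M.V t => f (x : M.V t)) (M.π_refl t)
    simpa [LinearMap.restrict_apply] using this
  π_comp s t r hst htr := by
    apply LinearMap.ext
    intro x
    apply Subtype.ext
    have := congrArg (fun f : M.V s →ₗ[𝔽] M.V r => f (x : M.V s)) (M.π_comp s t r hst htr)
    simpa [LinearMap.restrict_apply] using this

/-- `(δ, ℤ₂)`-equivariant interleaving of two persistence modules with involutions
`AM` and `AN`. -/
def Z2Interleaved (M N : PersistenceModule 𝔽) (AM : Hom M M) (AN : Hom N N) (δ : ℝ) : Prop :=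
  ∃ (F : ∀ t : ℝ, M.V t →ₗ[𝔽] N.V (t + δ)) (G : ∀ t : ℝ, N.V t →ₗ[𝔽] M.V (t + δ)),
    (∀ (s t : ℝ) (h : s ≤ t),
      (F t).comp (M.π s t h) = (N.π (s + δ) (t + δ) (by linarith)).comp (F s)) ∧
    (∀ (s t : ℝ) (h : s ≤ t),
      (G t).comp (N.π s t h) = (M.π (s + δ) (t + δ) (by linarith)).comp (G s)) ∧
    (∀ (t : ℝ) (h : t ≤ t + δ + δ),
      (G (t + δ)).comp (F t) = M.π t (t + δ + δ) h) ∧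
    (∀ (t : ℝ) (h : t ≤ t + δ + δ),
      (F (t + δ)).comp (G t) = N.π t (t + δ + δ) h) ∧
    (∀ t : ℝ, (F t).comp (AM.A t) = (AN.A (t + δ)).comp (F t)) ∧
    (∀ t : ℝ, (G t).comp (AN.A t) = (AM.A (t + δ)).comp (G t))

/-- The `ℤ₂`-interleaving distance, with value in `EReal`. -/
def dZ2Int (M N : PersistenceModule 𝔽) (AM : Hom M M) (AN : Hom N N) : EReal :=
  sInf {x : EReal | ∃ δ : ℝ, 0 < δ ∧ x = (δ : EReal) ∧ Z2Interleaved M N AM AN δ}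

end PersistenceModule

/-- A bar `(a, b]` is recorded as the pair of its left endpoint `a ∈ ℝ`
and its right endpoint `b ∈ ℝ ∪ {±∞}`. -/
abbrev Bar := ℝ × EReal

/-- A bar is valid if `a < b` (so it encodes a nonempty interval `(a,b]`, `b ≤ +∞`). -/
def Bar.valid (I : Bar) : Prop := (I.1 : EReal) < I.2

/-- Membership `t ∈ (a, b]`. -/
def Bar.has (I : Bar) (t : ℝ) : Prop := I.1 < t ∧ (t : EReal) ≤ I.2

/-- The fiber at `t` of the interval module of `I`, as a submodule of `𝔽`. -/
def barSub (𝔽 : Type) [Field 𝔽] (I : Bar) (t : ℝ) : Submodule 𝔽 𝔽 :=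
  if Bar.has I t then ⊤ else ⊥

lemma barSub_coe_zero {𝔽 : Type} [Field 𝔽] {I : Bar} {t : ℝ}
    (hm : ¬ Bar.has I t) (x : barSub 𝔽 I t) : (x : 𝔽) = 0 := by
  have hx := x.2
  simp only [barSub, if_neg hm, Submodule.mem_bot] at hx
  exact hx

/-- The transition maps of an interval module. -/
def barMap (𝔽 : Type) [Field 𝔽] (I : Bar) (s t : ℝ) :
    barSub 𝔽 I s →ₗ[𝔽] barSub 𝔽 I t where
  toFun x := ⟨if Bar.has I t then (x : 𝔽) else 0, by
    split_ifs with hm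
    · simp [barSub, hm]
    · exact (barSub 𝔽 I t).zero_mem⟩
  map_add' x y := by
    apply Subtype.ext
    by_cases hm : Bar.has I t <;> simp [hm]
  map_smul' c x := by
    apply Subtype.ext
    by_cases hm : Bar.has I t <;> simp [hm]

lemma barMap_coe (𝔽 : Type) [Field 𝔽] (I : Bar) (s t : ℝ) (x : barSub 𝔽 I s) :
    (barMap 𝔽 I s t x : 𝔽) = if Bar.has I t then (x : 𝔽) else 0 := rfl

lemma barMap_refl {𝔽 : Type} [Field 𝔽] {I : Bar} {t : ℝ} (x : barSub 𝔽 I t) :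
    barMap 𝔽 I t t x = x := by
  apply Subtype.ext
  rw [barMap_coe]
  split_ifs with hm
  · rfl
  · exact (barSub_coe_zero hm x).symm

lemma barMap_comp {𝔽 : Type} [Field 𝔽] {I : Bar} {s t r : ℝ} (hst : s ≤ t) (htr : t ≤ r)
    (x : barSub 𝔽 I s) :
    barMap 𝔽 I t r (barMap 𝔽 I s t x) = barMap 𝔽 I s r x := by
  apply Subtype.ext
  rw [barMap_coe, barMap_coe, barMap_coe]
  by_cases hr : Bar.has I r
  · by_cases ht : Bar.has I t
    · simp [hr, ht]
    · have ht2 : (t : EReal) ≤ I.2 := le_trans (by exact_mod_cast htr) hr.2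
      have ht1 : ¬ I.1 < t := fun h => ht ⟨h, ht2⟩
      have hs1 : ¬ Bar.has I s := fun hs => ht1 (lt_of_lt_of_le hs.1 hst)
      rw [barSub_coe_zero hs1 x]
      simp
  · simp [hr]

/-- The interval persistence module `𝔽(a,b]`. -/
def intervalModule (𝔽 : Type) [Field 𝔽] (I : Bar) : PersistenceModule 𝔽 where
  V t := ↥(barSub 𝔽 I t)
  π s t _ := barMap 𝔽 I s t
  π_refl t := LinearMap.ext fun x => barMap_refl x
  π_comp _ _ _ hst htr := LinearMap.ext fun x => barMap_comp hst htr x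

/-- The direct sum `⊕_{I ∈ B} 𝔽(I)` of the interval modules of the bars of a
barcode `B` (a finite multiset of bars), taken pointwise in `t`. -/
def barcodeModule (𝔽 : Type) [Field 𝔽] (B : Multiset Bar) : PersistenceModule 𝔽 where
  V t := ∀ i : Fin B.toList.length, ↥(barSub 𝔽 (B.toList.get i) t)
  π s t _ := LinearMap.pi fun i => (barMap 𝔽 (B.toList.get i) s t).comp (LinearMap.proj i)
  π_refl t := by
    apply LinearMap.ext
    intro x
    funext i
    simpa using barMap_refl (x i)
  π_comp s t r hst htr := by
    apply LinearMap.ext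
    intro x
    funext i
    simpa using barMap_comp hst htr (x i)

/-- `Multiset.filter` with classical decidability. -/
def cfilter {α : Type} (p : α → Prop) (s : Multiset α) : Multiset α :=
  @Multiset.filter α p (Classical.decPred p) s

/-- A bar of length `> 2δ`. -/
def BarLong (δ : ℝ) (I : Bar) : Prop := ((2 * δ : ℝ) : EReal) < I.2 - (I.1 : EReal)

/-- Two bars matched within error `δ`: left endpoints within `δ` of each other, and
either both right endpoints equal `+∞`, or both are finite and within `δ`. -/
def BarClose (δ : ℝ) (I J : Bar) : Prop :=
  |I.1 - J.1| ≤ δ ∧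
    ((I.2 = ⊤ ∧ J.2 = ⊤) ∨ (I.2 ≠ ⊤ ∧ J.2 ≠ ⊤ ∧ |EReal.toReal I.2 - EReal.toReal J.2| ≤ δ))

/-- A `δ`-matching between barcodes `B` and `C`, recorded as a multiset `m` of matched
pairs: it induces a partial bijection between a sub-multiset of `B` and a sub-multiset
of `C` which matches every bar of length `> 2δ` on both sides, and matched bars are
`δ`-close. -/
def IsMatching (δ : ℝ) (B C : Multiset Bar) (m : Multiset (Bar × Bar)) : Prop :=
  m.map Prod.fst ≤ B ∧ m.map Prod.snd ≤ C ∧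
  cfilter (BarLong δ) B ≤ m.map Prod.fst ∧
  cfilter (BarLong δ) C ≤ m.map Prod.snd ∧
  ∀ p ∈ m, BarClose δ p.1 p.2

/-- The bottleneck distance between two barcodes, with value in `EReal`. -/
def dBot (B C : Multiset Bar) : EReal :=
  sInf {x : EReal | ∃ δ : ℝ, 0 < δ ∧ x = (δ : EReal) ∧ ∃ m, IsMatching δ B C m}

/-- `m(B, (a,b])`: the number of bars of `B` (with multiplicity) containing `(a,b]`. -/
def multB (B : Multiset Bar) (a b : ℝ) : ℕ :=
  (cfilter (fun I : Bar => I.1 ≤ a ∧ (b : EReal) ≤ I.2) B).card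

/-- The multiplicity function `μ_k` of a barcode, with value in `EReal`
(it equals `0` if no suitable `c` exists). -/
def muk (k : ℕ) (B : Multiset Bar) : EReal :=
  sSup (insert (0 : EReal)
    {x : EReal | ∃ c : ℝ, 0 < c ∧ x = (c : EReal) ∧
      ∃ a b : ℝ, 4 * c < b - a ∧ multB B a b = k ∧ multB B (a + 2 * c) (b - 2 * c) = k})

/-- `μ_odd`: the supremum of `μ_k` over odd `k`. -/
def muOdd (B : Multiset Bar) : EReal :=
  sSup {x : EReal | ∃ k : ℕ, Odd k ∧ x = muk k B}

/-- `β_k`: the length of the `k`-th longest finite bar of a barcode (`0` if there are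
fewer than `k` finite bars). -/
def betak (k : ℕ) (B : Multiset Bar) : ℝ :=
  ((((cfilter (fun I : Bar => I.2 ≠ ⊤) B).map
      (fun I : Bar => EReal.toReal I.2 - I.1)).sort (· ≤ ·)).reverse).getD (k - 1) 0

end

namespace PersistenceModule

/-- Composition of morphisms of persistence modules. -/
def Hom.comp {𝔽 : Type} [Field 𝔽] {M N P : PersistenceModule 𝔽} (g : Hom N P) (f : Hom M N) :
    Hom M P where
  A t := (g.A t).comp (f.A t)
  comm s t h := by
    rw [LinearMap.comp_assoc, f.comm, ← LinearMap.comp_assoc, g.comm, LinearMap.comp_assoc]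

lemma Hom.comm_apply {𝔽 : Type} [Field 𝔽] {M N : PersistenceModule 𝔽} (f : Hom M N)
    {s t : ℝ} (h : s ≤ t) (x : M.V s) : f.A t (M.π s t h x) = N.π s t h (f.A s x) :=
  LinearMap.congr_fun (f.comm s t h) x

end PersistenceModule

lemma barcodeModule_π_coe (𝔽 : Type) [Field 𝔽] (B : Multiset Bar) {s t : ℝ} (h : s ≤ t)
    (x : (barcodeModule 𝔽 B).V s) (i : Fin B.toList.length) :
    (((barcodeModule 𝔽 B).π s t h x i : barSub 𝔽 (B.toList.get i) t) : 𝔽) =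
      if Bar.has (B.toList.get i) t then ((x i : barSub 𝔽 (B.toList.get i) s) : 𝔽) else 0 :=
  rfl

/-- The element of the fiber at `t` of a barcode module whose coordinates are those of `v`
at the bars alive at `t`. -/
noncomputable def barcodeVec (𝔽 : Type) [Field 𝔽] (B : Multiset Bar) (t : ℝ) :
    (Fin B.toList.length → 𝔽) →ₗ[𝔽] (barcodeModule 𝔽 B).V t :=
  LinearMap.pi fun i =>
    { toFun := fun v => ⟨if Bar.has (B.toList.get i) t then v i else 0, by
        split_ifs with hm
        · simp only [barSub, if_pos hm, Submodule.mem_top]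
        · exact (barSub 𝔽 (B.toList.get i) t).zero_mem⟩
      map_add' := fun v w => by
        apply Subtype.ext
        simp only [Pi.add_apply, Submodule.coe_add]
        split_ifs <;> simp
      map_smul' := fun c v => by
        apply Subtype.ext
        simp }

lemma barcodeVec_coe (𝔽 : Type) [Field 𝔽] (B : Multiset Bar) (t : ℝ)
    (v : Fin B.toList.length → 𝔽) (i : Fin B.toList.length) :
    ((barcodeVec 𝔽 B t v i : barSub 𝔽 (B.toList.get i) t) : 𝔽) =
      if Bar.has (B.toList.get i) t then v i else 0 :=
  rfl

/-- The coordinates of an element of the fiber at `t` of a barcode module. -/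
noncomputable def barcodeCoord (𝔽 : Type) [Field 𝔽] (B : Multiset Bar) (t : ℝ) :
    (barcodeModule 𝔽 B).V t →ₗ[𝔽] (Fin B.toList.length → 𝔽) :=
  LinearMap.pi fun i => (barSub 𝔽 (B.toList.get i) t).subtype.comp (LinearMap.proj i)

lemma exists_real_between_avoiding_right (C : Multiset Bar) {b : ℝ} {d : EReal}
    (hbd : (b : EReal) < d) :
    ∃ T : ℝ, b < T ∧ (T : EReal) < d ∧ ∀ J ∈ C, (T : EReal) ≤ J.2 → d ≤ J.2 := by
  have hs : ((C.toFinset.image Prod.snd).filter (· < d)).sup id ⊔ (b : EReal) < d := by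
    rw [sup_lt_iff, Finset.sup_lt_iff (bot_le.trans_lt hbd)]
    exact ⟨fun e he => (Finset.mem_filter.mp he).2, hbd⟩
  obtain ⟨T, h1, h2⟩ := EReal.lt_iff_exists_real_btwn.mp hs
  refine ⟨T, EReal.coe_lt_coe_iff.mp (le_sup_right.trans_lt h1), h2, fun J hJ hT => ?_⟩
  by_contra! hd
  have hmem : J.2 ∈ (C.toFinset.image Prod.snd).filter (· < d) :=
    Finset.mem_filter.mpr ⟨Finset.mem_image_of_mem _ (Multiset.mem_toFinset.mpr hJ), hd⟩
  have h3 : J.2 ≤ ((C.toFinset.image Prod.snd).filter (· < d)).sup id :=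
    Finset.le_sup (f := id) hmem
  exact absurd ((h3.trans le_sup_left).trans_lt h1) hT.not_gt

lemma exists_real_between_avoiding_left (C : Multiset Bar) {b T : ℝ} (hbT : b < T) :
    ∃ t : ℝ, b < t ∧ t ≤ T ∧ ∀ J ∈ C, J.1 < t → J.1 ≤ b := by
  have hne : (insert T ((C.toFinset.image Prod.fst).filter (b < ·))).Nonempty :=
    Finset.insert_nonempty _ _
  refine ⟨_, (Finset.lt_min'_iff _ hne).mpr fun a ha => ?_,
    Finset.min'_le _ _ (Finset.mem_insert_self _ _), fun J hJ hJt => ?_⟩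
  · rcases Finset.mem_insert.mp ha with rfl | ha
    · exact hbT
    · exact (Finset.mem_filter.mp ha).2
  · by_contra! hb
    refine absurd (Finset.min'_le _ J.1 ?_) hJt.not_ge
    exact Finset.mem_insert_of_mem (Finset.mem_filter.mpr
      ⟨Finset.mem_image_of_mem _ (Multiset.mem_toFinset.mpr hJ), hb⟩)

/-- A pointwise injective morphism of barcode modules can only increase the number of bars
with a given right endpoint whose left endpoint is at most a given number. -/
lemma card_bars_le_of_injective {𝔽 : Type} [Field 𝔽] {B C : Multiset Bar}
    (F : PersistenceModule.Hom (barcodeModule 𝔽 B) (barcodeModule 𝔽 C))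
    (hF : ∀ t, Function.Injective (F.A t)) {b : ℝ} {d : EReal} (hbd : (b : EReal) < d) :
    (Finset.univ.filter fun i : Fin B.toList.length =>
      (B.toList.get i).2 = d ∧ (B.toList.get i).1 ≤ b).card ≤
    (Finset.univ.filter fun j : Fin C.toList.length =>
      (C.toList.get j).2 = d ∧ (C.toList.get j).1 ≤ b).card := by
  obtain ⟨T, hbT, hTd, hT⟩ := exists_real_between_avoiding_right C hbd
  obtain ⟨t, hbt, htT, ht⟩ := exists_real_between_avoiding_left C hbT
  set P := Finset.univ.filter fun i : Fin B.toList.length =>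
      (B.toList.get i).2 = d ∧ (B.toList.get i).1 ≤ b
  set Q := Finset.univ.filter fun j : Fin C.toList.length =>
      (C.toList.get j).2 = d ∧ (C.toList.get j).1 ≤ b
  let L : (P → 𝔽) →ₗ[𝔽] (Q → 𝔽) :=
    (LinearMap.funLeft 𝔽 𝔽 (Subtype.val : Q → Fin C.toList.length)).comp
      ((barcodeCoord 𝔽 C T).comp ((F.A T).comp ((barcodeVec 𝔽 B T).comp
        (Function.ExtendByZero.linearMap 𝔽 (Subtype.val : P → Fin B.toList.length)))))
  have hL : Function.Injective L := by
    rw [← LinearMap.ker_eq_bot, LinearMap.ker_eq_bot']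
    intro v hv
    set w : Fin B.toList.length → 𝔽 :=
      Function.ExtendByZero.linearMap 𝔽 (Subtype.val : P → Fin B.toList.length) v
    have hwP : ∀ i, i ∉ P → w i = 0 := fun i hi =>
      Function.extend_apply' _ _ _ fun ⟨a, ha⟩ => hi (ha ▸ a.2)
    have hwv : ∀ i : P, w i = v i := fun i => Subtype.val_injective.extend_apply _ _ i
    have hasP : ∀ i ∈ P, ∀ s : ℝ, b < s → s ≤ T → Bar.has (B.toList.get i) s := by
      intro i hi s hbs hsT
      obtain ⟨h1, h2⟩ := (Finset.mem_filter.mp hi).2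
      refine ⟨h2.trans_lt hbs, ?_⟩
      rw [h1]
      exact (EReal.coe_le_coe_iff.mpr hsT).trans hTd.le
    have hpush : (barcodeModule 𝔽 B).π t T htT (barcodeVec 𝔽 B t w) = barcodeVec 𝔽 B T w := by
      funext i
      apply Subtype.ext
      rw [barcodeModule_π_coe, barcodeVec_coe, barcodeVec_coe]
      by_cases hi : i ∈ P
      · rw [if_pos (hasP i hi t hbt htT)]
      · simp [hwP i hi]
    have hzero : F.A T (barcodeVec 𝔽 B T w) = 0 := by
      funext j
      apply Subtype.ext
      change ((F.A T (barcodeVec 𝔽 B T w) j : barSub 𝔽 (C.toList.get j) T) : 𝔽) = 0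
      by_cases hjQ : j ∈ Q
      · exact congrFun hv ⟨j, hjQ⟩
      have hjC : C.toList.get j ∈ C := Multiset.mem_toList.mp (List.get_mem _ _)
      by_cases hjT : Bar.has (C.toList.get j) T
      swap
      · exact barSub_coe_zero hjT _
      by_cases hjt : (C.toList.get j).1 < t
      swap
      · rw [← hpush, PersistenceModule.Hom.comm_apply, barcodeModule_π_coe, if_pos hjT]
        exact barSub_coe_zero (fun h => hjt h.1) _
      have hlt : d < (C.toList.get j).2 := (hT _ hjC hjT.2).lt_of_ne fun h =>
        hjQ (Finset.mem_filter.mpr ⟨Finset.mem_univ _, h.symm, ht _ hjC hjt⟩)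
      obtain ⟨r, hdr, hrj⟩ := EReal.lt_iff_exists_real_btwn.mp hlt
      have hTr : T ≤ r := EReal.coe_le_coe_iff.mp (hTd.trans hdr).le
      have hkill : (barcodeModule 𝔽 B).π T r hTr (barcodeVec 𝔽 B T w) = 0 := by
        funext i
        apply Subtype.ext
        rw [barcodeModule_π_coe, barcodeVec_coe]
        by_cases hi : i ∈ P
        · rw [if_neg]
          · rfl
          · intro h
            have h2 := h.2
            rw [(Finset.mem_filter.mp hi).2.1] at h2
            exact absurd hdr h2.not_gt
        · simp only [hwP i hi, ite_self]
          rfl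
      have h := F.comm_apply hTr (barcodeVec 𝔽 B T w)
      rw [hkill, map_zero] at h
      have hj := barcodeModule_π_coe 𝔽 C hTr (F.A T (barcodeVec 𝔽 B T w)) j
      rw [if_pos ⟨hjT.1.trans_le hTr, hrj.le⟩, ← h] at hj
      exact hj.symm
    have hvec : barcodeVec 𝔽 B T w = 0 := hF T (hzero.trans (map_zero _).symm)
    funext i
    have h := barcodeVec_coe 𝔽 B T w i
    rw [if_pos (hasP i i.2 T hbT le_rfl), hwv i, hvec] at h
    exact h.symm
  simpa using LinearMap.finrank_le_finrank_of_injective hL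

/-- Matching bars with equal right endpoints, from bars to longer bars, under a counting
hypothesis on each right endpoint. -/
lemma exists_injective_of_card_bars_le {ι κ : Type} [Fintype ι] [Fintype κ]
    (I : ι → Bar) (J : κ → Bar)
    (h : ∀ i₀ : ι, (Finset.univ.filter fun i => (I i).2 = (I i₀).2 ∧ (I i).1 ≤ (I i₀).1).card ≤
      (Finset.univ.filter fun j => (J j).2 = (I i₀).2 ∧ (J j).1 ≤ (I i₀).1).card) :
    ∃ f : ι → κ, Function.Injective f ∧ ∀ i, (J (f i)).2 = (I i).2 ∧ (J (f i)).1 ≤ (I i).1 := by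
  let N : ι → Finset κ := fun i =>
    Finset.univ.filter fun j => (J j).2 = (I i).2 ∧ (J j).1 ≤ (I i).1
  obtain ⟨f, hf, hfN⟩ := (Finset.all_card_le_biUnion_card_iff_exists_injective N).mp fun s => by
    rw [Finset.card_eq_sum_card_image (fun i => (I i).2) s,
      Finset.card_eq_sum_card_fiberwise (f := fun j => (J j).2) (s := s.biUnion N)
        (t := s.image fun i => (I i).2)]
    · refine Finset.sum_le_sum fun d hd => ?_
      obtain ⟨k, hk, hkd⟩ := Finset.mem_image.mp hd
      obtain ⟨i₀, hi₀, hmax⟩ := (s.filter fun i => (I i).2 = d).exists_max_image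
        (fun i => (I i).1) ⟨k, Finset.mem_filter.mpr ⟨hk, hkd⟩⟩
      obtain ⟨hi₀s, rfl⟩ := Finset.mem_filter.mp hi₀
      refine (Finset.card_le_card fun i hi => ?_).trans
        ((h i₀).trans (Finset.card_le_card fun j hj => ?_))
      · exact Finset.mem_filter.mpr
          ⟨Finset.mem_univ _, (Finset.mem_filter.mp hi).2, hmax i hi⟩
      · exact Finset.mem_filter.mpr
          ⟨Finset.mem_biUnion.mpr ⟨i₀, hi₀s, hj⟩, (Finset.mem_filter.mp hj).2.1⟩
    · intro j hj
      obtain ⟨i, hi, hij⟩ := Finset.mem_biUnion.mp hj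
      exact Finset.mem_image.mpr ⟨i, hi, (Finset.mem_filter.mp hij).2.1.symm⟩
  exact ⟨f, hf, fun i => (Finset.mem_filter.mp (hfN i)).2⟩

lemma Multiset.map_univ_toList_get {α : Type} (s : Multiset α) :
    (Finset.univ : Finset (Fin s.toList.length)).val.map s.toList.get = s := by
  rw [Fin.univ_val_map, List.ofFn_get, Multiset.coe_toList]

/-- **Induced matching for injections.** If there is a pointwise injective morphism
`ι : M → N`, then there is an injective matching `m` of the whole multiset `B` into the
multiset `C` (recorded as a multiset of pairs) such that each bar `(b,d] ∈ B` is
matched to a bar `(c,d] ∈ C` with the same right endpoint and with `c ≤ b`. -/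
theorem induced_matching_injections {𝔽 : Type} [Field 𝔽]
    (M N : PersistenceModule 𝔽) (hM : M.IsRegular) (hN : N.IsRegular)
    (B C : Multiset Bar) (hB : ∀ I ∈ B, Bar.valid I) (hC : ∀ I ∈ C, Bar.valid I)
    (hMB : PersistenceModule.Iso M (barcodeModule 𝔽 B))
    (hNC : PersistenceModule.Iso N (barcodeModule 𝔽 C))
    (ι : PersistenceModule.Hom M N) (hι : ∀ t : ℝ, Function.Injective (ι.A t)) :
    ∃ m : Multiset (Bar × Bar),
      m.map Prod.fst = B ∧ m.map Prod.snd ≤ C ∧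
      ∀ p ∈ m, p.2.2 = p.1.2 ∧ p.2.1 ≤ p.1.1 := by
  obtain ⟨fM, gM, hgf, hfg⟩ := hMB
  obtain ⟨fN, gN, hgfN, hfgN⟩ := hNC
  have hF : ∀ t, Function.Injective ((fN.comp (ι.comp gM)).A t) := fun t =>
    (Function.LeftInverse.injective (hgfN t)).comp
      ((hι t).comp (Function.LeftInverse.injective (hfg t)))
  obtain ⟨f, hf, hfm⟩ := exists_injective_of_card_bars_le B.toList.get C.toList.get fun i =>
    card_bars_le_of_injective _ hF (hB _ (Multiset.mem_toList.mp (List.get_mem _ i)))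
  refine ⟨(Finset.univ : Finset (Fin B.toList.length)).val.map
    fun i => (B.toList.get i, C.toList.get (f i)), ?_, ?_, fun p hp => ?_⟩
  · rw [Multiset.map_map]
    exact B.map_univ_toList_get
  · rw [Multiset.map_map]
    calc (Finset.univ : Finset (Fin B.toList.length)).val.map (C.toList.get ∘ f)
        = ((Finset.univ : Finset (Fin B.toList.length)).map ⟨f, hf⟩).val.map C.toList.get := by
          rw [Finset.map_val, Multiset.map_map]
          rfl
      _ ≤ (Finset.univ : Finset (Fin C.toList.length)).val.map C.toList.get :=
          Multiset.map_le_map (Finset.val_le_iff.mpr (Finset.subset_univ _))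
      _ = C := C.map_univ_toList_get
  · obtain ⟨i, -, rfl⟩ := Multiset.mem_map.mp hp
    exact hfm i
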